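/- Let q ∈ [1,∞] with conjugate exponent q*, λ > 0, and p ∈ {1, ∞}. Then for every z ∈ ℝ^m and β ∈ ℝ^n, the maximum of ‖z + Δβ‖_p over all Δ ∈ ℝ^{m×n} with entrywise ℓ_q norm ‖Δ‖_{F_q} ≤ λ equals exactly ‖z‖_p + λ·δ_m(p,q)·‖β‖_{q*}, where δ_m(∞,q) = 1. -/

import Mathlib

open scoped ENNReal

noncomputable def lpNorm (p : ℝ≥0∞) {ι : Type*} [Fintype ι] (x : ι → ℝ) : ℝ :=
  ‖(WithLp.equiv p (ι → ℝ)).symm x‖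

noncomputable def frobNorm (p : ℝ≥0∞) {m n : ℕ} (A : Matrix (Fin m) (Fin n) ℝ) : ℝ :=
  lpNorm p (fun ij : Fin m × Fin n => A ij.1 ij.2)

noncomputable def discrep (m : ℕ) (a b : ℝ≥0∞) : ℝ :=
  sSup {t : ℝ | ∃ u : Fin m → ℝ, lpNorm b u = 1 ∧ t = lpNorm a u}

theorem exists_sign_vector {ι : Type*} (x : ι → ℝ) :
    ∃ s : ι → ℝ, (∀ i, |s i| = 1) ∧ ∀ i, s i * x i = |x i| := by
  refine ⟨fun i => if 0 ≤ x i then 1 else -1, fun i => ?_, fun i => ?_⟩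
  · dsimp only
    split_ifs <;> simp
  · dsimp only
    split_ifs with h
    · rw [one_mul, abs_of_nonneg h]
    · rw [neg_one_mul, abs_of_neg (not_le.1 h)]

section LpNorm

variable {ι κ : Type*} [Fintype ι] [Fintype κ] {p q : ℝ≥0∞}

theorem lpNorm_eq_sum (hp : 0 < p.toReal) (x : ι → ℝ) :
    lpNorm p x = (∑ i, |x i| ^ p.toReal) ^ (1 / p.toReal) :=
  PiLp.norm_eq_sum hp _

theorem lpNorm_one (x : ι → ℝ) : lpNorm 1 x = ∑ i, |x i| := by
  rw [lpNorm_eq_sum (by simp)]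
  simp

theorem lpNorm_top (x : ι → ℝ) : lpNorm ⊤ x = ‖x‖ :=
  PiLp.norm_toLp x

theorem lpNorm_nonneg (hp : 1 ≤ p) (x : ι → ℝ) : 0 ≤ lpNorm p x := by
  have : Fact (1 ≤ p) := ⟨hp⟩
  exact norm_nonneg (WithLp.toLp p x)

theorem lpNorm_add_le (hp : 1 ≤ p) (x y : ι → ℝ) :
    lpNorm p (x + y) ≤ lpNorm p x + lpNorm p y := by
  have : Fact (1 ≤ p) := ⟨hp⟩
  exact norm_add_le (WithLp.toLp p x) (WithLp.toLp p y)

theorem lpNorm_smul (hp : 1 ≤ p) (c : ℝ) (x : ι → ℝ) :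
    lpNorm p (c • x) = |c| * lpNorm p x := by
  have : Fact (1 ≤ p) := ⟨hp⟩
  exact norm_smul c (WithLp.toLp p x)

theorem abs_le_lpNorm (hp : 1 ≤ p) (x : ι → ℝ) (i : ι) : |x i| ≤ lpNorm p x := by
  have : Fact (1 ≤ p) := ⟨hp⟩
  exact PiLp.norm_apply_le (WithLp.toLp p x) i

theorem lpNorm_single [DecidableEq ι] (hp : 1 ≤ p) (i : ι) (c : ℝ) :
    lpNorm p (Pi.single i c : ι → ℝ) = |c| := by
  have : Fact (1 ≤ p) := ⟨hp⟩
  exact PiLp.norm_single p (fun _ : ι => ℝ) i c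

theorem lpNorm_mono (hp : 1 ≤ p) {x y : ι → ℝ} (h : ∀ i, |x i| ≤ |y i|) :
    lpNorm p x ≤ lpNorm p y := by
  rcases eq_or_ne p ⊤ with rfl | hp'
  · rw [lpNorm_top, lpNorm_top, pi_norm_le_iff_of_nonneg (norm_nonneg y)]
    exact fun i => (h i).trans (norm_le_pi_norm y i)
  · have h0 : 0 < p.toReal := ENNReal.toReal_pos (zero_lt_one.trans_le hp).ne' hp'
    rw [lpNorm_eq_sum h0, lpNorm_eq_sum h0]
    refine Real.rpow_le_rpow (by positivity) (Finset.sum_le_sum fun i _ => ?_) (by positivity)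
    exact Real.rpow_le_rpow (abs_nonneg _) (h i) h0.le

theorem lpNorm_congr_abs (hp : 1 ≤ p) {x y : ι → ℝ} (h : ∀ i, |x i| = |y i|) :
    lpNorm p x = lpNorm p y :=
  (lpNorm_mono hp fun i => (h i).le).antisymm (lpNorm_mono hp fun i => (h i).ge)

theorem lpNorm_prod (hp : 1 ≤ p) (x : ι → κ → ℝ) :
    lpNorm p (fun ij : ι × κ => x ij.1 ij.2) = lpNorm p fun i => lpNorm p (x i) := by
  rcases eq_or_ne p ⊤ with rfl | hp'
  · simp only [lpNorm_top]
    apply le_antisymm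
    · refine (pi_norm_le_iff_of_nonneg (norm_nonneg _)).2 fun ij => ?_
      exact (norm_le_pi_norm (x ij.1) ij.2).trans
        ((le_abs_self _).trans (norm_le_pi_norm (fun i => ‖x i‖) ij.1))
    · refine (pi_norm_le_iff_of_nonneg (norm_nonneg _)).2 fun i => ?_
      rw [norm_norm]
      exact (pi_norm_le_iff_of_nonneg (norm_nonneg _)).2 fun j =>
        norm_le_pi_norm (fun ij : ι × κ => x ij.1 ij.2) (i, j)
  · have h0 : 0 < p.toReal := ENNReal.toReal_pos (zero_lt_one.trans_le hp).ne' hp'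
    rw [lpNorm_eq_sum h0, lpNorm_eq_sum h0, Fintype.sum_prod_type]
    congr 1
    refine Finset.sum_congr rfl fun i _ => ?_
    rw [abs_of_nonneg (lpNorm_nonneg hp _), lpNorm_eq_sum h0, ← Real.rpow_mul (by positivity),
      one_div_mul_cancel h0.ne', Real.rpow_one]

theorem exists_abs_eq_norm [Nonempty ι] (x : ι → ℝ) : ∃ i, |x i| = ‖x‖ := by
  obtain ⟨i, -, hi⟩ := Finset.exists_max_image Finset.univ (fun i => |x i|) Finset.univ_nonempty
  exact ⟨i, (norm_le_pi_norm x i).antisymm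
    ((pi_norm_le_iff_of_nonneg (abs_nonneg _)).2 fun j => hi j (Finset.mem_univ j))⟩

theorem dotProduct_le_lpNorm_one_mul_top (x y : ι → ℝ) :
    x ⬝ᵥ y ≤ lpNorm 1 x * lpNorm ⊤ y := by
  rw [lpNorm_one, lpNorm_top, dotProduct, Finset.sum_mul]
  refine Finset.sum_le_sum fun i _ => (le_abs_self _).trans ?_
  rw [abs_mul]
  exact mul_le_mul_of_nonneg_left (norm_le_pi_norm y i) (abs_nonneg _)

/-- **Hölder's inequality** for `lpNorm`. -/
theorem dotProduct_le_lpNorm_mul_lpNorm [p.HolderConjugate q] (x y : ι → ℝ) :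
    x ⬝ᵥ y ≤ lpNorm p x * lpNorm q y := by
  rcases eq_or_ne p ⊤ with rfl | hp
  · obtain rfl : q = 1 := ENNReal.HolderConjugate.unique ⊤ q 1
    rw [dotProduct_comm, mul_comm]
    exact dotProduct_le_lpNorm_one_mul_top y x
  rcases eq_or_ne q ⊤ with rfl | hq
  · obtain rfl : p = 1 := ENNReal.HolderConjugate.unique ⊤ p 1
    exact dotProduct_le_lpNorm_one_mul_top x y
  have h := ENNReal.HolderConjugate.toReal_of_ne_top hp hq
  rw [lpNorm_eq_sum h.pos, lpNorm_eq_sum h.symm.pos]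
  exact Real.inner_le_Lp_mul_Lq _ _ _ h

/-- The dual norm of `lpNorm p` is attained. -/
theorem exists_dotProduct_eq_lpNorm [p.HolderConjugate q] (y : ι → ℝ) :
    ∃ x : ι → ℝ, lpNorm p x ≤ 1 ∧ x ⬝ᵥ y = lpNorm q y := by
  classical
  obtain ⟨s, hs, hsy⟩ := exists_sign_vector y
  rcases eq_or_ne p ⊤ with rfl | hp
  · obtain rfl : q = 1 := ENNReal.HolderConjugate.unique ⊤ q 1
    refine ⟨s, ?_, ?_⟩
    · rw [lpNorm_top, pi_norm_le_iff_of_nonneg zero_le_one]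
      exact fun i => (hs i).le
    · rw [lpNorm_one, dotProduct]
      exact Finset.sum_congr rfl fun i _ => hsy i
  rcases eq_or_ne q ⊤ with rfl | hq
  · obtain rfl : p = 1 := ENNReal.HolderConjugate.unique ⊤ p 1
    rcases isEmpty_or_nonempty ι with hι | hι
    · exact ⟨0, by simp [lpNorm_one], by simp [lpNorm_top, Subsingleton.elim y 0]⟩
    obtain ⟨i, hi⟩ := exists_abs_eq_norm y
    exact ⟨Pi.single i (s i), by rw [lpNorm_single le_rfl, hs],
      by rw [single_dotProduct, hsy, hi, lpNorm_top]⟩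
  have h := ENNReal.HolderConjugate.toReal_of_ne_top hp hq
  obtain ⟨g, hg, hgy⟩ := (NNReal.isGreatest_Lp Finset.univ (fun i => ‖y i‖₊) h.symm).1
  refine ⟨fun i => s i * g i, ?_, ?_⟩
  · rw [lpNorm_eq_sum h.pos]
    refine Real.rpow_le_one (by positivity) ?_ h.one_div_nonneg
    simpa [abs_mul, hs] using (NNReal.coe_le_coe.2 hg)
  · rw [lpNorm_eq_sum h.symm.pos, dotProduct]
    have := congrArg NNReal.toReal hgy
    push_cast at this
    simp only [Real.norm_eq_abs] at this
    rw [← this]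
    refine Finset.sum_congr rfl fun i _ => ?_
    rw [← hsy i]
    ring

end LpNorm

theorem lpNorm_mulVec_le {m n : ℕ} {p q : ℝ≥0∞} [p.HolderConjugate q] (hp : 1 ≤ p) (hq : 1 ≤ q)
    (A : Matrix (Fin m) (Fin n) ℝ) (β : Fin n → ℝ) :
    lpNorm p (A.mulVec β) ≤ frobNorm p A * lpNorm q β := by
  have hβ := lpNorm_nonneg hq β
  calc lpNorm p (A.mulVec β) ≤ lpNorm p (lpNorm q β • fun i => lpNorm p fun j => A i j) := by
        refine lpNorm_mono hp fun i => ?_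
        have h1 := dotProduct_le_lpNorm_mul_lpNorm (p := p) (q := q) (fun j => A i j) β
        have h2 := dotProduct_le_lpNorm_mul_lpNorm (p := p) (q := q) ((-1 : ℝ) • fun j => A i j) β
        rw [lpNorm_smul hp, smul_dotProduct, smul_eq_mul, abs_neg, abs_one] at h2
        rw [Pi.smul_apply, smul_eq_mul, abs_mul, abs_of_nonneg hβ,
          abs_of_nonneg (lpNorm_nonneg hp _), Matrix.mulVec, abs_le]
        constructor <;> linarith
    _ = frobNorm p A * lpNorm q β := by
        rw [lpNorm_smul hp, abs_of_nonneg hβ, mul_comm]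
        exact congrArg (· * lpNorm q β) (lpNorm_prod hp fun i j => A i j).symm

theorem frobNorm_vecMulVec {m n : ℕ} {p : ℝ≥0∞} (hp : 1 ≤ p) (u : Fin m → ℝ) (v : Fin n → ℝ) :
    frobNorm p (Matrix.vecMulVec u v) = lpNorm p u * lpNorm p v := by
  have hv := lpNorm_nonneg hp v
  calc frobNorm p (Matrix.vecMulVec u v) = lpNorm p fun i => lpNorm p (u i • v) :=
        lpNorm_prod hp fun i => u i • v
    _ = lpNorm p (lpNorm p v • u) := by
        refine lpNorm_congr_abs hp fun i => ?_
        rw [lpNorm_smul hp, Pi.smul_apply, smul_eq_mul, abs_mul, abs_mul, abs_abs, mul_comm]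
    _ = lpNorm p u * lpNorm p v := by rw [lpNorm_smul hp, abs_of_nonneg hv, mul_comm]

theorem discrep_eq {m : ℕ} {p q : ℝ≥0∞} {D : ℝ} (hD : 0 < D)
    (hle : ∀ x : Fin m → ℝ, lpNorm p x ≤ D * lpNorm q x) {u : Fin m → ℝ}
    (hu : lpNorm q u ≤ 1) (hDu : D ≤ lpNorm p u) : discrep m p q = D := by
  have hu1 : lpNorm q u = 1 := hu.antisymm <| by
    have := hDu.trans (hle u)
    nlinarith
  refine IsGreatest.csSup_eq ⟨⟨u, hu1, hDu.antisymm ?_⟩, ?_⟩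
  · simpa [hu1] using hle u
  · rintro t ⟨x, hx, rfl⟩
    simpa [hx] using hle x

/-- If `D` bounds `lpNorm p` by `lpNorm q`, and for every `z` some norming functional `w` of `z`
satisfies `w ⬝ᵥ u = D` for a vector `u` in the unit `q`-ball, then the robust maximum is
`lpNorm p z + lam * D * lpNorm qs β`. -/
theorem isGreatest_lpNorm_add_mulVec {m n : ℕ} {p q qs : ℝ≥0∞} [q.HolderConjugate qs]
    (hp : 1 ≤ p) (hq : 1 ≤ q) (hqs : 1 ≤ qs) {lam : ℝ} (hlam : 0 < lam) {D : ℝ} (hD : 0 < D)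
    (hle : ∀ x : Fin m → ℝ, lpNorm p x ≤ D * lpNorm q x) {z w u : Fin m → ℝ}
    (hw : ∀ x, w ⬝ᵥ x ≤ lpNorm p x) (hwz : w ⬝ᵥ z = lpNorm p z) (hu : lpNorm q u ≤ 1)
    (hwu : w ⬝ᵥ u = D) (β : Fin n → ℝ) :
    IsGreatest
      {t : ℝ | ∃ Δ : Matrix (Fin m) (Fin n) ℝ, frobNorm q Δ ≤ lam ∧
        t = lpNorm p (z + Δ.mulVec β)}
      (lpNorm p z + lam * D * lpNorm qs β) := by
  have hβ := lpNorm_nonneg hqs β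
  have upper : ∀ Δ : Matrix (Fin m) (Fin n) ℝ, frobNorm q Δ ≤ lam →
      lpNorm p (z + Δ.mulVec β) ≤ lpNorm p z + lam * D * lpNorm qs β := fun Δ hΔ =>
    calc lpNorm p (z + Δ.mulVec β) ≤ lpNorm p z + lpNorm p (Δ.mulVec β) := lpNorm_add_le hp _ _
      _ ≤ lpNorm p z + D * (frobNorm q Δ * lpNorm qs β) := by
          gcongr
          exact (hle _).trans (mul_le_mul_of_nonneg_left (lpNorm_mulVec_le hq hqs Δ β) hD.le)
      _ ≤ lpNorm p z + D * (lam * lpNorm qs β) := by gcongr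
      _ = lpNorm p z + lam * D * lpNorm qs β := by ring
  constructor
  · obtain ⟨v, hv, hvβ⟩ := exists_dotProduct_eq_lpNorm (p := q) (q := qs) β
    have hΔ : frobNorm q (Matrix.vecMulVec (lam • u) v) ≤ lam := by
      rw [frobNorm_vecMulVec hq, lpNorm_smul hq, abs_of_pos hlam, mul_assoc]
      exact mul_le_of_le_one_right hlam.le (mul_le_one₀ hu (lpNorm_nonneg hq v) hv)
    refine ⟨_, hΔ, le_antisymm ?_ (upper _ hΔ)⟩
    have hmul : (Matrix.vecMulVec (lam • u) v).mulVec β = (lam * lpNorm qs β) • u := by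
      ext i
      simp only [Matrix.vecMulVec_mulVec, hvβ, Pi.smul_apply, MulOpposite.smul_eq_mul_unop,
        MulOpposite.unop_op, smul_eq_mul]
      ring
    calc lpNorm p z + lam * D * lpNorm qs β = w ⬝ᵥ (z + (lam * lpNorm qs β) • u) := by
          rw [dotProduct_add, dotProduct_smul, hwz, hwu, smul_eq_mul]
          ring
      _ ≤ lpNorm p (z + (Matrix.vecMulVec (lam • u) v).mulVec β) := by
          rw [hmul]
          exact hw _
  · rintro t ⟨Δ, hΔ, rfl⟩
    exact upper Δ hΔ

/-- For p ∈ {1,∞}, robustification under q-Frobenius uncertainty is exactly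
equivalent to regularization with penalty λ·δ_m(p,q)·‖β‖_{q*}; also δ_m(∞,q) = 1. -/
theorem stmt10 {m n : ℕ} (hm : 0 < m) (p q qs : ℝ≥0∞) (hp : p = 1 ∨ p = ⊤)
    (hq : 1 ≤ q) (hqs : 1 / q + 1 / qs = 1) (lam : ℝ) (hlam : 0 < lam) :
    (∀ (z : Fin m → ℝ) (β : Fin n → ℝ),
      IsGreatest
        {t : ℝ | ∃ Δ : Matrix (Fin m) (Fin n) ℝ, frobNorm q Δ ≤ lam ∧
          t = lpNorm p (z + Δ.mulVec β)}
        (lpNorm p z + lam * discrep m p q * lpNorm qs β)) ∧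
    discrep m ⊤ q = 1 := by
  have : q.HolderConjugate qs := by
    rw [ENNReal.holderConjugate_iff]
    simpa using hqs
  have hqs1 : 1 ≤ qs := ENNReal.HolderConjugate.one_le qs q
  have : Nonempty (Fin m) := ⟨⟨0, hm⟩⟩
  have hle_top : ∀ x : Fin m → ℝ, lpNorm ⊤ x ≤ 1 * lpNorm q x := fun x => by
    rw [one_mul, lpNorm_top, pi_norm_le_iff_of_nonneg (lpNorm_nonneg hq x)]
    exact abs_le_lpNorm hq x
  have htop : discrep m ⊤ q = 1 :=
    discrep_eq one_pos hle_top (u := Pi.single ⟨0, hm⟩ 1)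
      (by rw [lpNorm_single hq, abs_one]) (by rw [lpNorm_single le_top, abs_one])
  refine ⟨fun z β => ?_, htop⟩
  obtain ⟨s, hs, hsz⟩ := exists_sign_vector z
  rcases hp with rfl | rfl
  · have hnorm : ∀ s : Fin m → ℝ, (∀ i, |s i| = 1) → lpNorm qs s = lpNorm qs (1 : Fin m → ℝ) :=
      fun s hs => lpNorm_congr_abs hqs1 fun i => by simp [hs]
    have hpos : 0 < lpNorm qs (1 : Fin m → ℝ) :=
      zero_lt_one.trans_le (by simpa using abs_le_lpNorm hqs1 (1 : Fin m → ℝ) ⟨0, hm⟩)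
    have hle : ∀ x : Fin m → ℝ, lpNorm 1 x ≤ lpNorm qs (1 : Fin m → ℝ) * lpNorm q x := fun x => by
      obtain ⟨r, hr, hrx⟩ := exists_sign_vector x
      have h := dotProduct_le_lpNorm_mul_lpNorm (p := qs) (q := q) r x
      rwa [hnorm r hr, dotProduct, Finset.sum_congr rfl fun i _ => hrx i, ← lpNorm_one] at h
    have hw : ∀ x, s ⬝ᵥ x ≤ lpNorm 1 x := fun x => by
      rw [lpNorm_one]
      refine Finset.sum_le_sum fun i _ => (le_abs_self _).trans ?_
      rw [abs_mul, hs, one_mul]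
    obtain ⟨u, hu, hus⟩ := exists_dotProduct_eq_lpNorm (p := q) (q := qs) s
    rw [hnorm s hs, dotProduct_comm] at hus
    rw [discrep_eq hpos hle hu (hus ▸ hw u)]
    refine isGreatest_lpNorm_add_mulVec le_rfl hq hqs1 hlam hpos hle hw ?_ hu hus β
    rw [lpNorm_one]
    exact Finset.sum_congr rfl fun i _ => hsz i
  · obtain ⟨i, hi⟩ := exists_abs_eq_norm z
    rw [htop]
    refine isGreatest_lpNorm_add_mulVec le_top hq hqs1 hlam one_pos hle_top
      (w := Pi.single i (s i)) (u := Pi.single i (s i)) (fun x => ?_) ?_ ?_ ?_ β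
    · rw [single_dotProduct]
      refine (le_abs_self _).trans ?_
      rw [abs_mul, hs, one_mul]
      exact abs_le_lpNorm le_top x i
    · rw [single_dotProduct, hsz, hi, lpNorm_top]
    · rw [lpNorm_single hq, hs]
    · rw [single_dotProduct, Pi.single_eq_same, ← abs_mul_abs_self, hs, one_mul]
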